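/- arXiv:1611.02746 — 8 statements merged into one kernel-verified Lean document; each statement's English description precedes it below -/
import Mathlib

section
/- Assume F has odd characteristic. Then for all nonzero b, b' ∈ F^*, N_b = N_{b'}; that is, the number of pairs (x,α) ∈ F^V × (F^*)^E with Q(x,α) = b is the same for every nonzero b. -/
/-- Let `F` be a finite field of odd characteristic and `M` a `V×E`
matrix over `F`.  For `b ∈ F` let `N_b` be the number of pairs
`(x,α) ∈ F^V × (F^*)^E` with `Q(x,α) = ∑_{e∈E} α_e (xM)_e² = b`.
Then `N_b = N_{b'}` for all nonzero `b, b'`. -/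
theorem stmt_4 {F V E : Type*} [Field F] [Fintype F]
    [Fintype V] [Fintype E]
    (hodd : Odd (ringChar F))
    (M : Matrix V E F)
    (N : F → ℕ)
    (hN : ∀ b : F, N b = Nat.card {p : (V → F) × (E → Fˣ) //
      ∑ e : E, (p.2 e : F) * (∑ v : V, p.1 v * M v e) ^ 2 = b})
    (b b' : F) (hb : b ≠ 0) (hb' : b' ≠ 0) :
    N b = N b' := by
  let c : Fˣ := Units.mk0 b' hb' / Units.mk0 b hb
  have hc : b' = c * b := by simp [c, hb]
  rw [hN, hN]
  refine Nat.card_congr <| Equiv.subtypeEquiv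
    ((Equiv.refl (V → F)).prodCongr (Equiv.mulLeft fun _ : E => c)) fun p => ?_
  simp [hc, mul_assoc, ← Finset.mul_sum]
end

section
/- Assume F has odd characteristic. Then N_0 − N_1 = q^{|V|} · #{α ∈ (F^*)^E : Mα = 0}, where Mα ∈ F^V is the vector with entries (Mα)_v = ∑_{e∈E} M_{v e} α_e; that is, (N_0 − N_1)/q^{|V|} equals the number of nowhere-zero vectors in the kernel of the map α ↦ Mα. -/
/-- Level sets `0` and `1` of a linear form differ in size exactly when the form is zero. -/
theorem card_dotProduct_eq_zero_sub_card_dotProduct_eq_one {F V : Type*} [Field F] [Fintype F]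
    [Fintype V] [DecidableEq F] [DecidableEq V] (w : V → F) :
    (∑ x : V → F, if x ⬝ᵥ w = 0 then (1 : ℤ) else 0) -
      (∑ x : V → F, if x ⬝ᵥ w = 1 then (1 : ℤ) else 0) =
      if w = 0 then (Fintype.card F : ℤ) ^ Fintype.card V else 0 := by
  split_ifs with hw
  · subst hw
    simp
  · obtain ⟨v, hv⟩ := Function.ne_iff.mp hw
    rw [sub_eq_zero]
    refine Fintype.sum_equiv (Equiv.addRight (Pi.single v (w v)⁻¹)) _ _ fun x => ?_
    have h : (w v)⁻¹ * w v = 1 := inv_mul_cancel₀ hv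
    simp [add_dotProduct, single_dotProduct, h]

/-- Over a field, rescaling a pair `(x, α)` of a vector and a tuple of units by the nonzero
coordinates of `y x`. -/
noncomputable def unitsRescale {F X E : Type*} [Field F] [DecidableEq F] (y : X → E → F) :
    X × (E → Fˣ) ≃ X × (E → Fˣ) :=
  Equiv.prodShear (Equiv.refl X) fun x =>
    Equiv.mulRight fun e => if h : y x e = 0 then 1 else Units.mk0 (y x e) h

theorem unitsRescale_snd_mul {F X E : Type*} [Field F] [DecidableEq F] (y : X → E → F)
    (p : X × (E → Fˣ)) (e : E) :
    ((unitsRescale y p).2 e : F) * y p.1 e = (p.2 e : F) * y p.1 e ^ 2 := by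
  by_cases h : y p.1 e = 0
  · simp [h]
  · simp [unitsRescale, h]
    ring

/-- The squares in `Q(x, α)` may be dropped without changing the number of solutions. -/
theorem natCard_sum_mul_sq_eq {F V E : Type*} [Field F] [Fintype F] [Fintype V] [Fintype E]
    [DecidableEq F] [DecidableEq V] [DecidableEq E] (M : Matrix V E F) (b : F) :
    (Nat.card {p : (V → F) × (E → Fˣ) //
      ∑ e : E, (p.2 e : F) * (∑ v : V, p.1 v * M v e) ^ 2 = b} : ℤ) =
      ∑ α : E → Fˣ, ∑ x : V → F,
        if x ⬝ᵥ (fun v => ∑ e : E, M v e * (α e : F)) = b then (1 : ℤ) else 0 := by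
  have key : Nat.card {p : (V → F) × (E → Fˣ) //
        ∑ e : E, (p.2 e : F) * (∑ v : V, p.1 v * M v e) ^ 2 = b} =
      Nat.card {p : (V → F) × (E → Fˣ) //
        p.1 ⬝ᵥ (fun v => ∑ e : E, M v e * (p.2 e : F)) = b} := by
    refine Nat.card_congr ((unitsRescale fun (x : V → F) e => ∑ v, x v * M v e).subtypeEquiv
      fun p => ?_)
    have h := unitsRescale_snd_mul (fun (x : V → F) e => ∑ v, x v * M v e) p
    simp only [← h, dotProduct, Finset.mul_sum]
    rw [Finset.sum_comm]
    refine Eq.congr_left (Finset.sum_congr rfl fun v _ => Finset.sum_congr rfl fun e _ => ?_)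
    simp only [unitsRescale, Equiv.prodShear_apply, Equiv.refl_apply]
    ring
  rw [key, Nat.card_eq_fintype_card, Fintype.card_subtype, Finset.card_filter, Nat.cast_sum,
    Fintype.sum_prod_type_right]
  simp only [Nat.cast_ite, Nat.cast_one, Nat.cast_zero]


/-- Let `F` be a finite field with `q` elements and odd characteristic,
`M` a `V×E` matrix over `F`.  For `b ∈ F` let `N_b` be the number of pairs
`(x,α) ∈ F^V × (F^*)^E` with `Q(x,α) = ∑_{e∈E} α_e (xM)_e² = b`.  Then
`N_0 − N_1 = q^{|V|} · #{α ∈ (F^*)^E : Mα = 0}`. -/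
theorem stmt_6 {F V E : Type*} [Field F] [Fintype F]
    [Fintype V] [Fintype E]
    (hodd : Odd (ringChar F))
    (M : Matrix V E F)
    (N : F → ℕ)
    (hN : ∀ b : F, N b = Nat.card {p : (V → F) × (E → Fˣ) //
      ∑ e : E, (p.2 e : F) * (∑ v : V, p.1 v * M v e) ^ 2 = b}) :
    (N 0 : ℤ) - N 1 =
      (Fintype.card F : ℤ) ^ (Fintype.card V) *
        Nat.card {α : E → Fˣ // ∀ v : V, ∑ e : E, M v e * (α e : F) = 0} := by
  classical
  rw [hN, hN, natCard_sum_mul_sq_eq, natCard_sum_mul_sq_eq, ← Finset.sum_sub_distrib]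
  simp only [card_dotProduct_eq_zero_sub_card_dotProduct_eq_one]
  rw [Nat.card_eq_fintype_card, Fintype.card_subtype, Finset.sum_ite, Finset.sum_const_zero,
    add_zero, Finset.sum_const, nsmul_eq_mul, mul_comm]
  simp only [funext_iff, Pi.zero_apply]
end

section
/- For every b ∈ F and all positive integers j, j', the number of pairs (x,α) ∈ F^V × (F^*)^E with Q_j(x,α) = b equals the number of pairs with Q_{j'}(x,α) = b; that is, N_b(j) is independent of j ≥ 1. -/
/-- For every element `y` of a field, the powers `y ^ j` and `y ^ j'` with positive exponents
differ by a unit factor. -/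
theorem exists_unit_mul_pow_eq_pow {F : Type*} [Field F] {j j' : ℕ} (hj : 1 ≤ j) (hj' : 1 ≤ j')
    (y : F) : ∃ c : Fˣ, (c : F) * y ^ j' = y ^ j := by
  by_cases hy : y = 0
  · exact ⟨1, by simp [hy, Nat.ne_of_gt hj, Nat.ne_of_gt hj']⟩
  · exact ⟨Units.mk0 y hy ^ j / Units.mk0 y hy ^ j', by simp [Units.val_div_eq_div_val, hy]⟩


/-- Let `F` be a finite field and `M` a `V×E` matrix over `F`.  For a
positive integer `j` and `b ∈ F` let `N_b(j)` be the number of pairs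
`(x,α) ∈ F^V × (F^*)^E` with `Q_j(x,α) = ∑_{e∈E} α_e (xM)_e^j = b`.
Then `N_b(j)` is independent of `j ≥ 1`. -/
theorem stmt_7 {F V E : Type*} [Field F] [Fintype F]
    [Fintype V] [Fintype E]
    (M : Matrix V E F)
    (N : F → ℕ → ℕ)
    (hN : ∀ (b : F) (j : ℕ), N b j = Nat.card {p : (V → F) × (E → Fˣ) //
      ∑ e : E, (p.2 e : F) * (∑ v : V, p.1 v * M v e) ^ j = b})
    (b : F) (j j' : ℕ) (hj : 1 ≤ j) (hj' : 1 ≤ j') :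
    N b j = N b j' := by
  choose c hc using exists_unit_mul_pow_eq_pow (F := F) hj hj'
  rw [hN, hN]
  refine Nat.card_congr (Equiv.subtypeEquiv (Equiv.prodShear (Equiv.refl (V → F))
    fun x => Equiv.mulRight fun e => c (∑ v : V, x v * M v e)) ?_)
  rintro ⟨x, α⟩
  simp [Equiv.prodShear, mul_assoc, hc]
end

section
/- Let N = #{x ∈ F^n : x B xᵀ = 0}. If m is odd then N = q^{n−1}. If m is even and m ≥ 2 then N = q^{n−m}·(q^{m−1} + (q−1)·q^{(m−2)/2}·η((−1)^{m/2}·d)). (If m = 0 then N = q^n.) -/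
open Matrix

namespace FiniteField

variable {F : Type*} [Field F] [Fintype F] [DecidableEq F]

local notation "η" => quadraticChar F

/-- The number of `y` with `b * y ^ 2 = a`, for `b ≠ 0`. -/
theorem card_mul_sq_eq (hF : ringChar F ≠ 2) {b : F} (hb : b ≠ 0) (a : F) :
    ∑ y : F, (if a - b * y ^ 2 = 0 then (1 : ℤ) else 0) = η (a * b) + 1 := by
  have h := quadraticChar_card_sqrts hF (a / b)
  have hη : η (a * b) = η (a / b) := by
    rw [show a * b = a / b * b ^ 2 by field_simp, map_mul, quadraticChar_sq_one' hb, mul_one]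
  rw [hη, ← h, Finset.sum_boole]
  congr 2
  ext y
  simp only [Finset.mem_filter, Finset.mem_univ, true_and, Set.mem_toFinset, Set.mem_ofPred_eq,
    sub_eq_zero, eq_div_iff hb]
  rw [eq_comm, mul_comm]

theorem sum_comp_sq (hF : ringChar F ≠ 2) (f : F → ℤ) :
    ∑ y : F, f (y ^ 2) = ∑ t : F, (η t + 1) * f t := by
  rw [← Finset.sum_fiberwise (s := Finset.univ) (g := fun y : F ↦ y ^ 2)]
  refine Finset.sum_congr rfl fun t _ ↦ ?_
  rw [Finset.sum_congr rfl (g := fun _ ↦ f t) fun y hy ↦ by rw [(Finset.mem_filter.1 hy).2],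
    Finset.sum_const, nsmul_eq_mul, ← quadraticChar_card_sqrts hF t]
  congr 3
  ext y
  simp

theorem sum_quadraticChar_mul_one_sub (hF : ringChar F ≠ 2) :
    ∑ s : F, η s * η (1 - s) = -η (-1) := by
  have h := jacobiSum_nontrivial_inv (quadraticChar_ne_one hF)
  rwa [(quadraticChar_isQuadratic F).inv] at h

/-- The quadratic character sum of `a - b * y ^ 2`. -/
theorem sum_quadraticChar_sub_mul_sq (hF : ringChar F ≠ 2) {b : F} (hb : b ≠ 0) (a : F) :
    ∑ y : F, η (a - b * y ^ 2) = η (-b) * ((if a = 0 then (Fintype.card F : ℤ) else 0) - 1) := by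
  by_cases ha : a = 0
  · subst ha
    have h : ∀ y : F, η (0 - b * y ^ 2) = η (-b) * (1 - if y = 0 then 1 else 0) := by
      intro y
      by_cases hy : y = 0
      · simp [hy]
      · rw [show 0 - b * y ^ 2 = -b * y ^ 2 by ring, map_mul, quadraticChar_sq_one' hy]
        simp [hy]
    simp_rw [h, ← Finset.mul_sum, Finset.sum_sub_distrib]
    simp
  · have hlin : ∑ t : F, η (a - b * t) = 0 := by
      rw [← quadraticChar_sum_zero hF]
      exact Fintype.sum_equiv ((Equiv.mulLeft₀ b hb).trans (Equiv.subLeft a)) _ _ fun t ↦ rfl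
    have hprod : ∑ t : F, η t * η (a - b * t) = -η (-b) := by
      have hab : a / b ≠ 0 := div_ne_zero ha hb
      rw [← Equiv.sum_comp (Equiv.mulLeft₀ (a / b) hab)]
      have h : ∀ s : F, η (a / b * s) * η (a - b * (a / b * s)) = η b * (η s * η (1 - s)) := by
        intro s
        rw [show a - b * (a / b * s) = a * (1 - s) by field_simp, map_mul, map_mul,
          ← one_mul (η b), ← quadraticChar_sq_one' hab,
          show η a = η (a / b) * η b by rw [← map_mul, div_mul_cancel₀ _ hb], map_pow]
        ring
      simp only [Equiv.mulLeft₀_apply, h, ← Finset.mul_sum, sum_quadraticChar_mul_one_sub hF]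
      rw [show -b = b * -1 by ring, map_mul]
      ring
    rw [sum_comp_sq hF fun t ↦ η (a - b * t)]
    simp_rw [add_mul, one_mul, Finset.sum_add_distrib, hlin, hprod]
    simp [ha]

/-- The number of representations of `a` by the diagonal form with coefficients `w`. -/
def diagCount {r : ℕ} (w : Fin r → F) (a : F) : ℤ :=
  ∑ x : Fin r → F, if ∑ i, w i * x i ^ 2 = a then 1 else 0

theorem diagCount_succ {r : ℕ} (w : Fin (r + 1) → F) (a : F) :
    diagCount w a = ∑ y : F, diagCount (Fin.tail w) (a - w 0 * y ^ 2) := by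
  unfold diagCount
  rw [← (Fin.consEquiv fun _ ↦ F).sum_comp, Fintype.sum_prod_type]
  refine Finset.sum_congr rfl fun y _ ↦ Finset.sum_congr rfl fun x _ ↦ ?_
  simp [Fin.sum_univ_succ, Fin.tail, eq_sub_iff_add_eq']

theorem diagCount_odd_of_even (hF : ringChar F ≠ 2) {k : ℕ}
    (ih : ∀ w : Fin (2 * k) → F, (∀ i, w i ≠ 0) → ∀ a,
      (Fintype.card F : ℤ) * diagCount w a = Fintype.card F ^ (2 * k) +
        ((if a = 0 then (Fintype.card F : ℤ) else 0) - 1) *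
          (Fintype.card F ^ k * η ((-1) ^ k * ∏ i, w i)))
    (w : Fin (2 * k + 1) → F) (hw : ∀ i, w i ≠ 0) (a : F) :
    diagCount w a = Fintype.card F ^ (2 * k) +
      Fintype.card F ^ k * η ((-1) ^ k * ∏ i, w i) * η a := by
  have hq : (Fintype.card F : ℤ) ≠ 0 := by exact_mod_cast Fintype.card_ne_zero
  apply mul_left_cancel₀ hq
  have hite : ∀ t : F, (if t = 0 then (Fintype.card F : ℤ) else 0) =
      Fintype.card F * if t = 0 then 1 else 0 := by simp
  rw [diagCount_succ, Finset.mul_sum]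
  simp_rw [ih (Fin.tail w) (fun i ↦ hw i.succ), hite, Finset.sum_add_distrib, ← Finset.sum_mul,
    Finset.sum_sub_distrib, ← Finset.mul_sum, card_mul_sq_eq hF (hw 0)]
  simp only [Finset.sum_const, Finset.card_univ, nsmul_eq_mul, Fin.prod_univ_succ, Fin.tail,
    map_mul]
  ring

theorem diagCount_even_of_odd (hF : ringChar F ≠ 2) {k : ℕ}
    (ih : ∀ w : Fin (2 * k + 1) → F, (∀ i, w i ≠ 0) → ∀ a,
      diagCount w a = Fintype.card F ^ (2 * k) +
        Fintype.card F ^ k * η ((-1) ^ k * ∏ i, w i) * η a)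
    (w : Fin (2 * k + 1 + 1) → F) (hw : ∀ i, w i ≠ 0) (a : F) :
    (Fintype.card F : ℤ) * diagCount w a = Fintype.card F ^ (2 * k + 1 + 1) +
      ((if a = 0 then (Fintype.card F : ℤ) else 0) - 1) *
        (Fintype.card F ^ (k + 1) * η ((-1) ^ (k + 1) * ∏ i, w i)) := by
  rw [diagCount_succ]
  simp_rw [ih (Fin.tail w) (fun i ↦ hw i.succ), Finset.sum_add_distrib, ← Finset.mul_sum,
    sum_quadraticChar_sub_mul_sq hF (hw 0)]
  rw [show -w 0 = -1 * w 0 by ring]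
  simp only [Finset.sum_const, Finset.card_univ, nsmul_eq_mul, Fin.prod_univ_succ, Fin.tail,
    map_mul, pow_succ]
  ring

theorem diagCount_even (hF : ringChar F ≠ 2) (k : ℕ) :
    ∀ w : Fin (2 * k) → F, (∀ i, w i ≠ 0) → ∀ a,
      (Fintype.card F : ℤ) * diagCount w a = Fintype.card F ^ (2 * k) +
        ((if a = 0 then (Fintype.card F : ℤ) else 0) - 1) *
          (Fintype.card F ^ k * η ((-1) ^ k * ∏ i, w i)) := by
  induction k with
  | zero =>
    intro w _ a
    have h : diagCount w a = if a = 0 then 1 else 0 := by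
      have hs : ∀ x : Fin (2 * 0) → F, ∑ i, w i * x i ^ 2 = 0 := fun x ↦ Fin.sum_univ_zero _
      unfold diagCount
      simp only [hs, eq_comm (a := (0 : F)), Finset.sum_const, Finset.card_univ]
      simp
    have hp : ∏ i, w i = 1 := Fin.prod_univ_zero _
    rw [h, hp]
    simp
  | succ k ih => exact diagCount_even_of_odd hF (diagCount_odd_of_even hF ih)

theorem diagCount_odd (hF : ringChar F ≠ 2) (k : ℕ) (w : Fin (2 * k + 1) → F)
    (hw : ∀ i, w i ≠ 0) (a : F) :
    diagCount w a = Fintype.card F ^ (2 * k) +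
      Fintype.card F ^ k * η ((-1) ^ k * ∏ i, w i) * η a :=
  diagCount_odd_of_even hF (diagCount_even hF k) w hw a

end FiniteField

namespace Matrix

/-- A symmetric matrix over a field of characteristic not two is congruent to a diagonal one. -/
theorem IsSymm.exists_eq_transpose_mul_diagonal_mul {K : Type*} [Field K] (h2 : (2 : K) ≠ 0)
    {m : ℕ} {A : Matrix (Fin m) (Fin m) K} (hA : A.IsSymm) :
    ∃ (T : Matrix (Fin m) (Fin m) K) (w : Fin m → K),
      IsUnit T.det ∧ A = Tᵀ * diagonal w * T := by
  have : Invertible (2 : K) := invertibleOfNonzero h2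
  have hsymm : LinearMap.IsSymm (Matrix.toBilin' A) := by
    refine ⟨fun x y ↦ ?_⟩
    simp only [Matrix.toBilin'_apply', RingHom.id_apply]
    rw [dotProduct_mulVec, ← mulVec_transpose, hA.eq, dotProduct_comm]
  obtain ⟨v, hv⟩ := LinearMap.BilinForm.exists_orthogonal_basis hsymm
  let c := v.reindex (finCongr (Module.finrank_fin_fun K))
  let e := Pi.basisFun K (Fin m)
  have hdiag : LinearMap.BilinForm.toMatrix c (Matrix.toBilin' A) =
      diagonal fun i ↦ Matrix.toBilin' A (c i) (c i) := by
    ext i j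
    rw [LinearMap.BilinForm.toMatrix_apply, diagonal_apply]
    split_ifs with h
    · rw [h]
    · simp only [c, Module.Basis.reindex_apply]
      exact hv fun h' ↦ h ((finCongr _).symm.injective h')
  have hone : c.toMatrix e * e.toMatrix c = 1 := Module.Basis.toMatrix_mul_toMatrix_flip _ _
  refine ⟨c.toMatrix e, fun i ↦ Matrix.toBilin' A (c i) (c i), ?_, ?_⟩
  · exact (isUnit_iff_isUnit_det _).1 (IsUnit.of_mul_eq_one _ hone)
  · rw [← hdiag, LinearMap.BilinForm.toMatrix_mul_basis_toMatrix,
      LinearMap.BilinForm.toMatrix_basisFun, LinearMap.BilinForm.toMatrix'_toBilin']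

/-- A symmetric matrix `B` is determined by `EᵀB` once `EᵀBE` is invertible of size at least the
rank of `B`. -/
theorem IsSymm.exists_eq_transpose_mul_mul {K : Type*} [Field K] {n m : ℕ}
    {B : Matrix (Fin n) (Fin n) K} (hB : B.IsSymm) (hrank : B.rank ≤ m)
    (E : Matrix (Fin n) (Fin m) K) (hE : IsUnit (Eᵀ * B * E).det) :
    ∃ P : Matrix (Fin m) (Fin n) K, P * E = 1 ∧ B = Pᵀ * (Eᵀ * B * E) * P := by
  have hle : LinearMap.ker B.mulVecLin ≤ LinearMap.ker (Eᵀ * B).mulVecLin := by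
    intro x hx
    simp only [LinearMap.mem_ker, mulVecLin_apply] at hx ⊢
    rw [← mulVec_mulVec, hx, mulVec_zero]
  have hm : m ≤ (Eᵀ * B).rank := by
    have h := rank_mul_le_left (Eᵀ * B) E
    rwa [rank_of_isUnit _ ((isUnit_iff_isUnit_det _).2 hE), Fintype.card_fin] at h
  have hker : LinearMap.ker B.mulVecLin = LinearMap.ker (Eᵀ * B).mulVecLin := by
    refine Submodule.eq_of_le_of_finrank_le hle ?_
    have h₁ := B.mulVecLin.finrank_range_add_finrank_ker
    have h₂ := (Eᵀ * B).mulVecLin.finrank_range_add_finrank_ker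
    simp only [rank] at hrank hm
    omega
  set A := Eᵀ * B * E with hAdef
  let P := A⁻¹ * (Eᵀ * B)
  have hAP : A * P = Eᵀ * B := mul_nonsing_inv_cancel_left _ _ hE
  have hBP : B = B * E * P := by
    have hzero : Eᵀ * B * (1 - E * P) = 0 := by
      rw [Matrix.mul_sub, Matrix.mul_one, ← Matrix.mul_assoc, ← hAdef, hAP, sub_self]
    have hzero' : B * (1 - E * P) = 0 := by
      refine ext_of_mulVec_single fun j ↦ ?_
      have hmem : (1 - E * P) *ᵥ Pi.single j 1 ∈ LinearMap.ker B.mulVecLin := by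
        rw [hker, LinearMap.mem_ker, mulVecLin_apply, mulVec_mulVec, hzero, zero_mulVec]
      rw [← mulVec_mulVec, zero_mulVec]
      exact hmem
    rwa [Matrix.mul_sub, Matrix.mul_one, ← Matrix.mul_assoc, sub_eq_zero] at hzero'
  refine ⟨P, ?_, ?_⟩
  · rw [show P * E = A⁻¹ * A by simp only [P, hAdef, Matrix.mul_assoc], nonsing_inv_mul _ hE]
  · have ht : B = Pᵀ * (Eᵀ * B) := by
      conv_lhs => rw [← hB.eq, hBP]
      simp only [transpose_mul, hB.eq]
    rw [Matrix.mul_assoc, hAP, ← ht]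

/-- Counting the solutions of a condition pulled back along a matrix with a right inverse. -/
theorem card_comp_mulVec {F : Type*} [Field F] [Fintype F] {n m : ℕ}
    (P : Matrix (Fin m) (Fin n) F) (E : Matrix (Fin n) (Fin m) F) (hPE : P * E = 1)
    (p : (Fin m → F) → Prop) :
    Nat.card {x : Fin n → F // p (P *ᵥ x)} =
      Fintype.card F ^ (n - m) * Nat.card {u : Fin m → F // p u} := by
  have hinv : ∀ u, P *ᵥ (E *ᵥ u) = u := fun u ↦ by rw [mulVec_mulVec, hPE, one_mulVec]
  let φ : {x : Fin n → F // p (P *ᵥ x)} ≃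
      LinearMap.ker P.mulVecLin × {u : Fin m → F // p u} :=
    { toFun := fun x ↦ (⟨x.1 - E *ᵥ (P *ᵥ x.1), by
        rw [LinearMap.mem_ker, mulVecLin_apply, mulVec_sub, hinv, sub_self]⟩, ⟨P *ᵥ x.1, x.2⟩)
      invFun := fun y ↦ ⟨y.1.1 + E *ᵥ y.2.1, by
        have h : P *ᵥ y.1.1 = 0 := y.1.2
        simpa [mulVec_add, hinv, h] using y.2.2⟩
      left_inv := fun x ↦ by simp
      right_inv := fun y ↦ by
        have h : P *ᵥ y.1.1 = 0 := y.1.2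
        ext <;> simp [mulVec_add, hinv, h] }
  have hsurj : Function.Surjective P.mulVecLin := fun u ↦ ⟨E *ᵥ u, hinv u⟩
  have hfin : Module.finrank F (LinearMap.ker P.mulVecLin) = n - m := by
    have h := P.mulVecLin.finrank_range_add_finrank_ker
    rw [LinearMap.range_eq_top.2 hsurj, finrank_top, Module.finrank_fin_fun,
      Module.finrank_fin_fun] at h
    omega
  rw [Nat.card_congr φ, Nat.card_prod, Module.natCard_eq_pow_finrank (K := F), hfin,
    Nat.card_eq_fintype_card]

end Matrix


/-- Let `F` be a finite field with `q` elements and odd characteristic,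
`B` a symmetric `n×n` matrix over `F` of rank `m`, and `S` a set of `m` indices such that
the principal minor `d = det(B[S,S])` is nonzero.  Let
`N = #{x ∈ F^n : x B xᵀ = 0}`.  If `m` is odd then `N = q^{n−1}`; if `m` is even and
`m ≥ 2` then `N = q^{n−m}·(q^{m−1} + (q−1)·q^{(m−2)/2}·η((−1)^{m/2}·d))`; and if `m = 0`
then `N = q^n`.  (`η` is the quadratic character of `F`.) -/
theorem stmt_9 {F : Type*} [Field F] [Fintype F] [DecidableEq F]
    (hodd : Odd (ringChar F))
    {n m : ℕ} (B : Matrix (Fin n) (Fin n) F)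
    (hsymm : B.IsSymm) (hrank : B.rank = m)
    (S : Finset (Fin n)) (hScard : S.card = m)
    (hd : (B.submatrix (Subtype.val : {i // i ∈ S} → Fin n) Subtype.val).det ≠ 0)
    (N : ℕ)
    (hN : N = Nat.card {x : Fin n → F // ∑ i : Fin n, ∑ j : Fin n, x i * B i j * x j = 0}) :
    (m % 2 = 1 → N = Fintype.card F ^ (n - 1)) ∧
    (m % 2 = 0 → 2 ≤ m →
      (N : ℤ) = (Fintype.card F : ℤ) ^ (n - m) *
        ((Fintype.card F : ℤ) ^ (m - 1) +
          ((Fintype.card F : ℤ) - 1) * (Fintype.card F : ℤ) ^ ((m - 2) / 2) *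
            quadraticChar F ((-1) ^ (m / 2) *
              (B.submatrix (Subtype.val : {i // i ∈ S} → Fin n) Subtype.val).det))) ∧
    (m = 0 → N = Fintype.card F ^ n) := by
  have hF : ringChar F ≠ 2 := fun h ↦ absurd (h ▸ hodd) (by decide)
  have hq : (Fintype.card F : ℤ) ≠ 0 := by exact_mod_cast Fintype.card_ne_zero
  let e : Fin m ≃ {i // i ∈ S} := (S.equivFinOfCardEq hScard).symm
  let E : Matrix (Fin n) (Fin m) F := (1 : Matrix _ _ F).submatrix id fun i ↦ (e i).1
  set d := (B.submatrix (Subtype.val : {i // i ∈ S} → Fin n) Subtype.val).det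
  have hdet : (Eᵀ * B * E).det = d := by
    rw [show d = _ from (det_submatrix_equiv_self e _).symm]
    congr 1
    ext i j
    simp [E, mul_apply, one_apply]
  have hmn : m ≤ n := by simpa [hScard] using S.card_le_univ
  obtain ⟨P, hPE, hBP⟩ := hsymm.exists_eq_transpose_mul_mul hrank.le E
    (by rw [hdet]; exact hd.isUnit)
  have hA : (Eᵀ * B * E).IsSymm := by
    simp only [IsSymm, transpose_mul, transpose_transpose, hsymm.eq, Matrix.mul_assoc]
  obtain ⟨T, w, hT, hAT⟩ := hA.exists_eq_transpose_mul_diagonal_mul (Ring.two_ne_zero hF)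
  have hdw : d = T.det ^ 2 * ∏ i, w i := by
    rw [← hdet, hAT, det_mul, det_mul, det_transpose, det_diagonal]
    ring
  have hw : ∀ i, w i ≠ 0 := fun i hi ↦ hd <| by
    rw [hdw, Finset.prod_eq_zero (Finset.mem_univ i) hi, mul_zero]
  have hη : ∀ k : ℕ, quadraticChar F ((-1) ^ k * d) =
      quadraticChar F ((-1) ^ k * ∏ i, w i) := fun k ↦ by
    rw [hdw, mul_left_comm, map_mul, quadraticChar_sq_one' hT.ne_zero, one_mul]
  have hform : ∀ x : Fin n → F, ∑ i, ∑ j, x i * B i j * x j =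
      ∑ i, w i * ((T * P) *ᵥ x) i ^ 2 := fun x ↦ by
    have h₁ : ∑ i, ∑ j, x i * B i j * x j = x ⬝ᵥ B *ᵥ x := by
      simp only [dotProduct, mulVec, Finset.mul_sum, mul_assoc]
    have h₂ : B = (T * P)ᵀ * (diagonal w * (T * P)) := by
      rw [hBP, hAT]
      simp only [transpose_mul, Matrix.mul_assoc]
    rw [h₁, h₂, ← mulVec_mulVec, dotProduct_mulVec, vecMul_transpose, ← mulVec_mulVec _ (diagonal w)]
    simp only [dotProduct, mulVec_diagonal]
    exact Finset.sum_congr rfl fun i _ ↦ by ring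
  have hcount : (N : ℤ) = (Fintype.card F : ℤ) ^ (n - m) * FiniteField.diagCount w 0 := by
    have hTPE : T * P * (E * T⁻¹) = 1 := by
      rw [Matrix.mul_assoc, ← Matrix.mul_assoc P, hPE, Matrix.one_mul, mul_nonsing_inv _ hT]
    simp_rw [hN, hform]
    rw [card_comp_mulVec (T * P) _ hTPE fun u ↦ ∑ i, w i * u i ^ 2 = 0, FiniteField.diagCount,
      Finset.sum_boole, Nat.card_eq_fintype_card, Fintype.card_subtype]
    push_cast
    rfl
  refine ⟨fun hm ↦ ?_, fun hm hm2 ↦ ?_, fun hm ↦ ?_⟩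
  · obtain ⟨k, rfl⟩ : ∃ k, m = 2 * k + 1 := ⟨m / 2, by omega⟩
    rw [FiniteField.diagCount_odd hF k w hw, MulChar.map_zero, mul_zero, add_zero, ← pow_add,
      show n - (2 * k + 1) + 2 * k = n - 1 by omega] at hcount
    exact_mod_cast hcount
  · obtain ⟨k, rfl⟩ : ∃ k, m = 2 * (k + 1) := ⟨m / 2 - 1, by omega⟩
    rw [hcount]
    congr 1
    apply mul_left_cancel₀ hq
    rw [FiniteField.diagCount_even hF (k + 1) w hw, show 2 * (k + 1) / 2 = k + 1 by omega, hη,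
      show (2 * (k + 1) - 2) / 2 = k by omega, show 2 * (k + 1) - 1 = 2 * k + 1 by omega,
      if_pos rfl]
    ring
  · subst hm
    have h := FiniteField.diagCount_even hF 0 w hw 0
    simp only [Nat.mul_zero, pow_zero, if_true] at h
    have hp : ∏ i, w i = 1 := Fin.prod_univ_zero _
    rw [hp, mul_one, map_one] at h
    have h1 : FiniteField.diagCount w 0 = 1 := mul_left_cancel₀ hq (by rw [h]; ring)
    rw [h1, mul_one, Nat.sub_zero] at hcount
    exact_mod_cast hcount
end

section
/- Assume r(E) = |V|. Then for every subset A ⊆ E, the number of row vectors x ∈ F^V such that (xM)_e = 0 for all e ∈ A and (xM)_e ≠ 0 for all e ∈ E∖A equals ∑_{B ⊆ E∖A} (−1)^{|B|} q^{r(E) − r(A∪B)}, i.e. it equals χ_{M/A}(q), the value at q of the characteristic polynomial of the contraction M/A. -/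
/-- The number of row vectors orthogonal to the columns indexed by `A` is `q ^ (|V| - rank)`. -/
theorem Matrix.natCard_leftKernel_submatrix {F V E : Type*} [Field F] [Fintype F] [Fintype V]
    (M : Matrix V E F) (A : Finset E) :
    Nat.card {x : V → F // ∀ e ∈ A, ∑ v, x v * M v e = 0} =
      Fintype.card F ^ (Fintype.card V -
        (M.submatrix id (Subtype.val : {e // e ∈ A} → E)).rank) := by
  set N := M.submatrix id (Subtype.val : {e // e ∈ A} → E)
  have hker : ∀ x : V → F,
      (∀ e ∈ A, ∑ v, x v * M v e = 0) ↔ x ∈ LinearMap.ker N.vecMulLinear := fun x => by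
    simp [funext_iff, Matrix.vecMul, dotProduct, N]
  have hrank : Module.finrank F (LinearMap.range N.vecMulLinear) = N.rank := by
    rw [← Matrix.rank_transpose, Matrix.rank, Matrix.mulVecLin_transpose]
  have hdim := LinearMap.finrank_range_add_finrank_ker N.vecMulLinear
  rw [hrank, Module.finrank_fintype_fun_eq_card] at hdim
  rw [Nat.card_congr (Equiv.subtypeEquivRight hker), ← hdim, Nat.add_sub_cancel_left,
    ← Nat.card_eq_fintype_card]
  exact Module.natCard_eq_pow_finrank

/-- Crapo–Rota for contractions.  Let `F` be a finite field with `q`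
elements and `M` a `V×E` matrix over `F` with `r(E) = |V|`.  For every `A ⊆ E`, the number
of row vectors `x ∈ F^V` with `(xM)_e = 0` for all `e ∈ A` and `(xM)_e ≠ 0` for all
`e ∈ E∖A` equals `χ_{M/A}(q) = ∑_{B ⊆ E∖A} (−1)^{|B|} q^{r(E)−r(A∪B)}`. -/
theorem stmt_12 {F V E : Type*} [Field F] [Fintype F]
    [Fintype V] [Fintype E] [DecidableEq E]
    (M : Matrix V E F)
    (r : Finset E → ℕ)
    (hr : ∀ A : Finset E,
      r A = (M.submatrix id (Subtype.val : {e // e ∈ A} → E)).rank)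
    (hfull : r Finset.univ = Fintype.card V)
    (A : Finset E) :
    (Nat.card {x : V → F //
        (∀ e ∈ A, ∑ v : V, x v * M v e = 0) ∧
        (∀ e ∉ A, ∑ v : V, x v * M v e ≠ 0)} : ℤ) =
      ∑ B ∈ Aᶜ.powerset, (-1 : ℤ) ^ B.card *
        (Fintype.card F : ℤ) ^ (r Finset.univ - r (A ∪ B)) := by
  classical
  have hcount : ∀ B ∈ Aᶜ.powerset,
      (Fintype.card F : ℤ) ^ (r Finset.univ - r (A ∪ B)) =
        ∑ x : V → F, (if ∀ e ∈ A, ∑ v, x v * M v e = 0 then 1 else 0) *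
          ∏ e ∈ B, (if ∑ v, x v * M v e = 0 then (1 : ℤ) else 0) := by
    intro B _
    rw [hfull, hr, ← Nat.cast_pow, ← Matrix.natCard_leftKernel_submatrix, Nat.card_eq_fintype_card,
      Fintype.card_subtype, Finset.natCast_card_filter]
    refine Finset.sum_congr rfl fun x _ => ?_
    rw [Finset.prod_ite_zero, Finset.prod_const_one, ite_zero_mul_ite_zero, one_mul]
    simp only [Finset.forall_mem_union]
    congr
  rw [Finset.sum_congr rfl fun B hB => by rw [hcount B hB], Nat.card_eq_fintype_card,
    Fintype.card_subtype, Finset.natCast_card_filter]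
  simp_rw [Finset.mul_sum]
  rw [Finset.sum_comm]
  refine Finset.sum_congr rfl fun x _ => ?_
  have hprod : ∏ e ∈ Aᶜ, (1 - if ∑ v, x v * M v e = 0 then (1 : ℤ) else 0) =
      if ∀ e ∉ A, ∑ v, x v * M v e ≠ 0 then 1 else 0 := by
    have h : ∀ e, (1 - if ∑ v, x v * M v e = 0 then (1 : ℤ) else 0) =
        if ∑ v, x v * M v e ≠ 0 then 1 else 0 := fun e => by split_ifs <;> simp_all
    simp_rw [h, Finset.prod_ite_zero]
    simp
  calc _ = (if ∀ e ∈ A, ∑ v, x v * M v e = 0 then (1 : ℤ) else 0) *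
          ∏ e ∈ Aᶜ, (1 - if ∑ v, x v * M v e = 0 then (1 : ℤ) else 0) := by
        rw [hprod, ite_zero_mul_ite_zero, one_mul]
    _ = _ := by
        rw [Finset.prod_sub, Finset.mul_sum]
        simp only [Finset.prod_const_one, mul_one, mul_left_comm]
end

section
/- For all a, b ∈ ℂ, q^{|V|} · 𝓕̃_G(q; a, b) = 𝓕_G(q; b, a·q). -/
/-- An additive character turns finite sums into products. -/
theorem AddChar.map_finset_sum {ι A M : Type*} [AddCommMonoid A] [CommMonoid M]
    (ψ : AddChar A M) (s : Finset ι) (g : ι → A) : ψ (∑ j ∈ s, g j) = ∏ j ∈ s, ψ (g j) :=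
  map_prod ψ.toMonoidHom (fun j => Multiplicative.ofAdd (g j)) s

/-- The pairing of a chain `k` with the differences of `x` equals the pairing of `x` with the
divergence of `k`. -/
theorem sum_mul_sub_eq_sum_mul_divergence {V E R : Type*} [Fintype V] [DecidableEq V] [Fintype E]
    [CommRing R] (i f : E → V) (k : E → R) (x : V → R) :
    ∑ e, k e * (x (f e) - x (i e)) =
      ∑ v, x v * ((∑ e ∈ Finset.univ.filter (fun e : E => f e = v), k e) -
        ∑ e ∈ Finset.univ.filter (fun e : E => i e = v), k e) := by
  have key (g : E → V) :
      ∑ v, x v * ∑ e ∈ Finset.univ.filter (fun e : E => g e = v), k e = ∑ e, k e * x (g e) := by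
    simp_rw [Finset.sum_filter, Finset.mul_sum, mul_ite, mul_zero]
    rw [Finset.sum_comm]
    simp [mul_comm]
  simp_rw [mul_sub, Finset.sum_sub_distrib, key]

/-- The Fourier transform of `a + b δ` on a finite ring is `b + a q δ`. -/
theorem AddChar.IsPrimitive.sum_mul_add_ite {R : Type*} [CommRing R] [Fintype R] [DecidableEq R]
    {ψ : AddChar R ℂ} (hψ : ψ.IsPrimitive) (a b : ℂ) (c : R) :
    ∑ t, ψ (t * c) * (a + b * (if t = 0 then (1 : ℂ) else 0)) =
      b + (a * (Fintype.card R : ℂ)) * (if c = 0 then (1 : ℂ) else 0) := by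
  simp_rw [mul_add, Finset.sum_add_distrib, ← Finset.sum_mul, AddChar.sum_mulShift c hψ]
  split_ifs <;> simp [add_comm, mul_comm]

/-- Orthogonality of characters on `V → R`. -/
theorem AddChar.IsPrimitive.sum_apply_sum_mul {V R : Type*} [Fintype V] [DecidableEq V]
    [CommRing R] [Fintype R] [DecidableEq R]
    {ψ : AddChar R ℂ} (hψ : ψ.IsPrimitive) (d : V → R) :
    ∑ x : V → R, ψ (∑ v, x v * d v) =
      if ∀ v, d v = 0 then (Fintype.card R : ℂ) ^ Fintype.card V else 0 := by
  simp_rw [AddChar.map_finset_sum]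
  rw [← Fintype.prod_sum (fun v t => ψ (t * d v))]
  simp_rw [AddChar.sum_mulShift _ hψ]
  split_ifs with h
  · simp [h]
  · obtain ⟨v, hv⟩ := not_forall.mp h
    exact Finset.prod_eq_zero (Finset.mem_univ v) (by simp [hv])


/-- Let `G = (V,E,i,f)` be a multigraph and `F` a finite field with `q`
elements.  With `δ(0) = 1`, `δ(c) = 0` otherwise, the vacuum Feynman amplitudes in
coordinate and momentum space are
`𝓕_G(q;a,b) = ∑_{x : V → F} ∏_{e∈E} (a + b·δ(x(i e) − x(f e)))` and
`𝓕̃_G(q;a,b) = ∑_{k flow} ∏_{e∈E} (a + b·δ(k e))`, the latter sum over `k : E → F` with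
`∑_{f e = v} k e − ∑_{i e = v} k e = 0` for every `v`.  Then for all `a, b ∈ ℂ`,
`q^{|V|} · 𝓕̃_G(q;a,b) = 𝓕_G(q;b,a·q)`. -/
theorem stmt_13 {V E F : Type*} [Fintype V] [DecidableEq V] [Fintype E] [DecidableEq E]
    [Field F] [Fintype F] [DecidableEq F]
    (i f : E → V) (a b : ℂ) :
    (Fintype.card F : ℂ) ^ (Fintype.card V) *
      (∑ k ∈ Finset.univ.filter (fun k : E → F => ∀ v : V,
          (∑ e ∈ Finset.univ.filter (fun e : E => f e = v), k e) -
            (∑ e ∈ Finset.univ.filter (fun e : E => i e = v), k e) = 0),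
        ∏ e : E, (a + b * (if k e = 0 then (1 : ℂ) else 0))) =
      ∑ x : V → F, ∏ e : E,
        (b + (a * (Fintype.card F : ℂ)) *
          (if x (i e) - x (f e) = 0 then (1 : ℂ) else 0)) := by
  obtain ⟨ψ, hψ⟩ : ∃ ψ : AddChar F ℂ, ψ.IsPrimitive :=
    ⟨_, AddChar.FiniteField.primitiveChar_to_Complex_isPrimitive F⟩
  have hedge (x : V → F) (e : E) :
      b + (a * (Fintype.card F : ℂ)) * (if x (i e) - x (f e) = 0 then (1 : ℂ) else 0) =
        ∑ t, ψ (t * (x (f e) - x (i e))) * (a + b * (if t = 0 then (1 : ℂ) else 0)) := by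
    rw [hψ.sum_mul_add_ite]
    simp only [sub_eq_zero, eq_comm]
  simp_rw [hedge, Fintype.prod_sum, Finset.prod_mul_distrib, ← AddChar.map_finset_sum,
    sum_mul_sub_eq_sum_mul_divergence]
  rw [Finset.sum_comm]
  simp_rw [← Finset.sum_mul, hψ.sum_apply_sum_mul, Finset.sum_filter, Finset.mul_sum,
    mul_ite, ite_mul, mul_zero, zero_mul]
end

section
/- For all a, b ∈ ℂ, 𝓕̃_G(q; a, b) = ∑_{A⊆E} a^{|A|} · b^{|E|−|A|} · q^{|A|−|V|+c(A)} (note that |A| − |V| + c(A) ≥ 0 for every A ⊆ E, so all exponents are natural numbers); this is the identity 𝓕̃_G(q;a,b) = a^{|V|} b^{|E|−|V|} Q_G(b/a, q·a/b) with Q_G the dichromatic polynomial. -/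
namespace Multigraph

/-- The incidence matrix over `F` of the spanning subgraph with edge set `A`. -/
def incidence {V E : Type*} (F : Type*) [DecidableEq V] [Field F] (i f : E → V)
    (A : Finset E) : Matrix V A F :=
  Matrix.of fun v e => (if f e = v then 1 else 0) - (if i e = v then 1 else 0)

variable {V E F : Type*} [DecidableEq V] [Field F]

lemma incidence_mulVec (i f : E → V) (A : Finset E) (k : A → F) (v : V) :
    (incidence F i f A).mulVec k v =
      ∑ e : A, ((if f e = v then k e else 0) - (if i e = v then k e else 0)) := by
  simp [incidence, Matrix.mulVec, dotProduct, sub_mul]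

variable [Fintype V]

lemma incidence_transpose_mulVec (i f : E → V) (A : Finset E) (φ : V → F) (e : A) :
    (incidence F i f A).transpose.mulVec φ e = φ (f e) - φ (i e) := by
  simp [incidence, Matrix.mulVec, dotProduct, sub_mul, Finset.sum_sub_distrib]

/-- The potentials killed by the coboundary are those constant on connected components. -/
lemma ker_incidence_transpose (i f : E → V) (A : Finset E) :
    LinearMap.ker (incidence F i f A).transpose.mulVecLin =
      LinearMap.range (LinearMap.funLeft F F (Quotient.mk
        (Relation.EqvGen.setoid (fun u w : V => ∃ e ∈ A, i e = u ∧ f e = w)))) := by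
  ext φ
  simp only [LinearMap.mem_ker, Matrix.mulVecLin_apply, LinearMap.mem_range]
  constructor
  · intro h
    have hφ : ∀ u w : V, Relation.EqvGen (fun u w : V => ∃ e ∈ A, i e = u ∧ f e = w) u w →
        φ u = φ w := by
      intro u w huw
      induction huw with
      | rel u w huw =>
        obtain ⟨e, he, rfl, rfl⟩ := huw
        have := congrFun h ⟨e, he⟩
        rw [incidence_transpose_mulVec] at this
        exact (sub_eq_zero.mp this).symm
      | refl => rfl
      | symm _ _ _ ih => exact ih.symm
      | trans _ _ _ _ _ ih₁ ih₂ => exact ih₁.trans ih₂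
    exact ⟨Quotient.lift φ hφ, rfl⟩
  · rintro ⟨ψ, rfl⟩
    ext e
    rw [incidence_transpose_mulVec, Pi.zero_apply, sub_eq_zero]
    refine congrArg ψ (Quotient.sound ?_)
    exact Relation.EqvGen.symm _ _ (Relation.EqvGen.rel _ _ ⟨e, e.2, rfl, rfl⟩)

lemma rank_incidence_add_card_components (i f : E → V) (A : Finset E) :
    (incidence F i f A).rank + Nat.card
      (Quotient (Relation.EqvGen.setoid (fun u w : V => ∃ e ∈ A, i e = u ∧ f e = w))) =
      Fintype.card V := by
  classical
  set s := Relation.EqvGen.setoid (fun u w : V => ∃ e ∈ A, i e = u ∧ f e = w) with hs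
  have hker : Module.finrank F (LinearMap.ker (incidence F i f A).transpose.mulVecLin) =
      Nat.card (Quotient s) := by
    rw [ker_incidence_transpose, LinearMap.finrank_range_of_inj
      (LinearMap.funLeft_injective_of_surjective F F _ Quotient.mk_surjective),
      Module.finrank_fintype_fun_eq_card, Nat.card_eq_fintype_card]
  have h := LinearMap.finrank_range_add_finrank_ker (incidence F i f A).transpose.mulVecLin
  rw [hker, Module.finrank_fintype_fun_eq_card] at h
  rw [← Matrix.rank_transpose]
  exact h

lemma card_ker_incidence [Fintype F] (i f : E → V) (A : Finset E) :
    Nat.card (LinearMap.ker (incidence F i f A).mulVecLin) =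
      Fintype.card F ^ (A.card + Nat.card (Quotient (Relation.EqvGen.setoid
        (fun u w : V => ∃ e ∈ A, i e = u ∧ f e = w))) - Fintype.card V) := by
  have h := LinearMap.finrank_range_add_finrank_ker (incidence F i f A).mulVecLin
  rw [Module.finrank_fintype_fun_eq_card, Fintype.card_coe] at h
  have h' := rank_incidence_add_card_components (F := F) i f A
  rw [Matrix.rank] at h'
  rw [Module.natCard_eq_pow_finrank (K := F), Nat.card_eq_fintype_card]
  congr 1
  omega

/-- Flows vanishing off `A` are the flows of the spanning subgraph with edge set `A`. -/
lemma card_flows_supported [Fintype E] [DecidableEq E] [Fintype F] [DecidableEq F]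
    (i f : E → V) (A : Finset E) :
    (Finset.univ.filter (fun k : E → F => (∀ v : V,
        (∑ e ∈ Finset.univ.filter (fun e : E => f e = v), k e) -
          (∑ e ∈ Finset.univ.filter (fun e : E => i e = v), k e) = 0) ∧
        ∀ e ∉ A, k e = 0)).card =
      Nat.card (LinearMap.ker (incidence F i f A).mulVecLin) := by
  have hsum : ∀ (k : E → F), (∀ e ∉ A, k e = 0) → ∀ v : V,
      (∑ e ∈ Finset.univ.filter (fun e : E => f e = v), k e) -
        (∑ e ∈ Finset.univ.filter (fun e : E => i e = v), k e) =
      (incidence F i f A).mulVec (fun e => k e) v := by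
    intro k hk v
    rw [incidence_mulVec, Finset.sum_filter, Finset.sum_filter, ← Finset.sum_sub_distrib,
      Finset.sum_coe_sort A
        (fun e => (if f e = v then k e else 0) - (if i e = v then k e else 0))]
    refine (Finset.sum_subset (Finset.subset_univ A) fun e _ he => ?_).symm
    simp [hk e he]
  rw [← Fintype.card_subtype, ← Nat.card_eq_fintype_card]
  refine Nat.card_congr
    { toFun := fun k => ⟨fun e => k.1 e, ?_⟩
      invFun := fun k => ⟨fun e => if h : e ∈ A then k.1 ⟨e, h⟩ else 0, ?_, ?_⟩
      left_inv := ?_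
      right_inv := ?_ }
  · rw [LinearMap.mem_ker, Matrix.mulVecLin_apply]
    ext v
    rw [← hsum k.1 k.2.2 v]
    exact k.2.1 v
  · intro v
    rw [hsum _ (fun e he => by simp [he]) v]
    have h : (incidence F i f A).mulVec k.1 = 0 := LinearMap.mem_ker.mp k.2
    simpa using congrFun h v
  · intro e he
    simp [he]
  · intro k
    ext e
    by_cases h : e ∈ A
    · simp [h]
    · simp [h, k.2.2 e h]
  · intro k
    ext e
    simp

end Multigraph

/-- Let `G = (V,E,i,f)` be a multigraph and `F` a finite field with `q`
elements; `δ(0) = 1`, `δ(c) = 0` otherwise.  For `A ⊆ E` let `c(A)` be the number of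
equivalence classes of the equivalence relation on `V` generated by `i e ∼ f e` for
`e ∈ A`.  Then for all `a, b ∈ ℂ`,
`𝓕̃_G(q;a,b) = ∑_{k flow} ∏_{e∈E} (a + b·δ(k e)) = ∑_{A⊆E} a^{|A|} b^{|E|−|A|} q^{|A|−|V|+c(A)}`
(the exponent `|A| − |V| + c(A)` is a natural number, written here as `|A| + c(A) − |V|`). -/
theorem stmt_15 {V E F : Type*} [Fintype V] [DecidableEq V] [Fintype E] [DecidableEq E]
    [Field F] [Fintype F] [DecidableEq F]
    (i f : E → V) (a b : ℂ)
    (c : Finset E → ℕ)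
    (hc : ∀ A : Finset E, c A = Nat.card
      (Quotient (Relation.EqvGen.setoid (fun u w : V => ∃ e ∈ A, i e = u ∧ f e = w)))) :
    (∑ k ∈ Finset.univ.filter (fun k : E → F => ∀ v : V,
        (∑ e ∈ Finset.univ.filter (fun e : E => f e = v), k e) -
          (∑ e ∈ Finset.univ.filter (fun e : E => i e = v), k e) = 0),
      ∏ e : E, (a + b * (if k e = 0 then (1 : ℂ) else 0))) =
      ∑ A : Finset E, a ^ A.card * b ^ (Fintype.card E - A.card) *
        (Fintype.card F : ℂ) ^ (A.card + c A - Fintype.card V) := by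
  have hprod : ∀ k : E → F, ∏ e : E, (a + b * (if k e = 0 then (1 : ℂ) else 0)) =
      ∑ A : Finset E, if ∀ e ∉ A, k e = 0 then
        a ^ A.card * b ^ (Fintype.card E - A.card) else 0 := by
    intro k
    rw [Finset.prod_add, Finset.powerset_univ]
    refine Finset.sum_congr rfl fun A _ => ?_
    rw [Finset.prod_const, Finset.prod_mul_distrib, Finset.prod_const, Finset.prod_ite_zero,
      ← Finset.compl_eq_univ_sdiff, Finset.card_compl]
    simp
  simp_rw [hprod]
  rw [Finset.sum_comm]
  refine Finset.sum_congr rfl fun A _ => ?_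
  rw [← Finset.sum_filter, Finset.filter_filter, Finset.sum_const,
    Multigraph.card_flows_supported, Multigraph.card_ker_incidence, ← hc, nsmul_eq_mul, mul_comm]
  push_cast
  rfl
end

section
/- q^{|V|} · F_G(q) = ∑_{A⊆E} (−1)^{|E|−|A|} · (q−1)^{|A|} · N_A, where N_A = #{x : V → F | x(i(e)) = x(f(e)) for all e ∈ A, and x(i(e)) ≠ x(f(e)) for all e ∈ E∖A}; the number N_A equals P_{G/A}(q), the number of proper colorings of the multigraph obtained from G by contracting the edges of A. -/
open Finset

lemma addChar_sum_eq_prod {ι G R : Type*} [AddCommMonoid G] [CommMonoid R] (ψ : AddChar G R)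
    (s : Finset ι) (g : ι → G) : ψ (∑ j ∈ s, g j) = ∏ j ∈ s, ψ (g j) :=
  map_prod ψ.toMonoidHom (fun j => Multiplicative.ofAdd (g j)) s

/-- The sum of `ψ (k * a)` over the nonzero elements `k` of a finite field. -/
lemma sum_ne_zero_primitive_addChar {F : Type*} [Field F] [Fintype F] [DecidableEq F]
    {ψ : AddChar F ℂ} (hψ : ψ.IsPrimitive) (a : F) :
    ∑ k ∈ univ.filter (fun k : F => k ≠ 0), ψ (k * a) =
      if a = 0 then (Fintype.card F : ℂ) - 1 else -1 := by
  have h := AddChar.sum_mulShift a hψ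
  rw [← Finset.sum_filter_add_sum_filter_not univ (fun k : F => k ≠ 0)] at h
  have h0 : univ.filter (fun k : F => ¬ k ≠ 0) = {0} := by ext; simp
  rw [h0, Finset.sum_singleton, zero_mul, AddChar.map_zero_eq_one] at h
  rw [eq_sub_of_add_eq h]
  split_ifs <;> simp

/-- Orthogonality of the characters of `V → F`. -/
lemma sum_primitive_addChar_dotProduct {V F : Type*} [Fintype V] [DecidableEq V] [Field F]
    [Fintype F] [DecidableEq F] {ψ : AddChar F ℂ} (hψ : ψ.IsPrimitive) (d : V → F) :
    ∑ x : V → F, ψ (∑ v, x v * d v) =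
      if ∀ v, d v = 0 then (Fintype.card F : ℂ) ^ Fintype.card V else 0 := by
  have h : ∀ x : V → F, ψ (∑ v, x v * d v) = ∏ v, ψ (x v * d v) := fun x =>
    addChar_sum_eq_prod ψ _ _
  simp_rw [h]
  rw [← Fintype.prod_sum (fun v t => ψ (t * d v))]
  simp_rw [AddChar.sum_mulShift _ hψ]
  split_ifs with hd
  · simp [hd]
  · push Not at hd
    obtain ⟨v, hv⟩ := hd
    exact Finset.prod_eq_zero (mem_univ v) (by simp [hv])

/-- Pairing a potential with the divergence of `k` gives the pairing of `k` with the coboundary. -/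
lemma sum_mul_divergence {V E F : Type*} [Fintype V] [DecidableEq V] [Fintype E] [Field F]
    (i f : E → V) (x : V → F) (k : E → F) :
    ∑ v, x v * ((∑ e ∈ univ.filter (fun e : E => f e = v), k e) -
      (∑ e ∈ univ.filter (fun e : E => i e = v), k e)) = ∑ e, k e * (x (f e) - x (i e)) := by
  have h : ∀ g : E → V, ∑ v, x v * (∑ e ∈ univ.filter (fun e : E => g e = v), k e) =
      ∑ e, k e * x (g e) := by
    intro g
    simp_rw [Finset.sum_filter, Finset.mul_sum]
    rw [Finset.sum_comm]
    exact Finset.sum_congr rfl fun e _ => by simp [mul_comm]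
  simp_rw [mul_sub, Finset.sum_sub_distrib, h]

/-- Fourier expansion of the number of nowhere-zero flows. -/
lemma card_pow_mul_card_nowhereZeroFlow {V E F : Type*} [Fintype V] [DecidableEq V] [Fintype E]
    [Field F] [Fintype F] [DecidableEq F] (i f : E → V) :
    (Fintype.card F : ℤ) ^ (Fintype.card V) *
      (Nat.card {k : E → F // (∀ e : E, k e ≠ 0) ∧ ∀ v : V,
        (∑ e ∈ univ.filter (fun e : E => f e = v), k e) -
          (∑ e ∈ univ.filter (fun e : E => i e = v), k e) = 0} : ℕ) =
      ∑ x : V → F, ∏ e : E, if x (i e) = x (f e) then (Fintype.card F : ℤ) - 1 else -1 := by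
  classical
  obtain ⟨ψ, hψ⟩ : ∃ ψ : AddChar F ℂ, ψ.IsPrimitive :=
    ⟨_, AddChar.FiniteField.primitiveChar_to_Complex_isPrimitive F⟩
  apply Int.cast_injective (α := ℂ)
  have hprod : ∀ x : V → F,
      ((∏ e : E, if x (i e) = x (f e) then (Fintype.card F : ℤ) - 1 else -1 : ℤ) : ℂ) =
        ∑ k ∈ Fintype.piFinset (fun _ : E => univ.filter (fun t : F => t ≠ 0)),
          ψ (∑ v, x v * ((∑ e ∈ univ.filter (fun e : E => f e = v), k e) -
            (∑ e ∈ univ.filter (fun e : E => i e = v), k e))) := by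
    intro x
    simp_rw [sum_mul_divergence, addChar_sum_eq_prod]
    rw [← Finset.prod_univ_sum (fun _ : E => univ.filter (fun t : F => t ≠ 0))
      (fun e t => ψ (t * (x (f e) - x (i e))))]
    simp_rw [sum_ne_zero_primitive_addChar hψ, sub_eq_zero, eq_comm (a := x (f _))]
    push_cast
    rfl
  rw [Int.cast_sum]
  simp_rw [hprod]
  rw [Finset.sum_comm]
  simp_rw [sum_primitive_addChar_dotProduct hψ]
  rw [← Finset.sum_filter, Finset.sum_const, Nat.card_eq_fintype_card, Fintype.card_subtype,
    nsmul_eq_mul, mul_comm]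
  push_cast
  congr 3
  ext k
  simp [Fintype.mem_piFinset]

/-- Sorting the potentials by the set of edges on which they are constant. -/
lemma sum_prod_ite_eq_sum_finset {V E F : Type*} [Fintype V] [DecidableEq V]
    [Fintype E] [Fintype F] [DecidableEq F] (i f : E → V) (c : ℤ) :
    (∑ x : V → F, ∏ e : E, if x (i e) = x (f e) then c else -1) =
      ∑ A : Finset E, (-1 : ℤ) ^ (Fintype.card E - A.card) * c ^ A.card *
        (Nat.card {x : V → F //
          (∀ e ∈ A, x (i e) = x (f e)) ∧ (∀ e ∉ A, x (i e) ≠ x (f e))} : ℕ) := by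
  classical
  rw [← Finset.sum_fiberwise univ (fun x : V → F => univ.filter (fun e : E => x (i e) = x (f e)))]
  refine Finset.sum_congr rfl fun A _ => ?_
  rw [Nat.card_eq_fintype_card, Fintype.card_subtype, mul_comm, ← nsmul_eq_mul,
    ← Finset.sum_const]
  refine Finset.sum_congr ?_ ?_
  · ext x
    simp only [mem_filter, mem_univ, true_and, Finset.ext_iff]
    grind
  · intro x hx
    replace hx : univ.filter (fun e : E => x (i e) = x (f e)) = A := by
      simp only [mem_filter, mem_univ, true_and] at hx
      ext e
      simp only [mem_filter, mem_univ, true_and]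
      grind
    have hA : univ.filter (fun e : E => ¬ x (i e) = x (f e)) = Aᶜ := by
      rw [← hx]; ext; simp
    rw [Finset.prod_ite, Finset.prod_const, Finset.prod_const, hA, hx, card_compl, mul_comm]

/-- Colorings that are constant on the edges of `A` and proper elsewhere are the proper
colorings of the contraction by `A`. -/
lemma card_coloring_eq_card_contraction {V E F : Type*} (i f : E → V) (A : Finset E) (s : Setoid V)
    (hs : s = Relation.EqvGen.setoid (fun u w : V => ∃ e ∈ A, i e = u ∧ f e = w)) :
    Nat.card {x : V → F //
        (∀ e ∈ A, x (i e) = x (f e)) ∧ (∀ e ∉ A, x (i e) ≠ x (f e))} =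
      Nat.card {cq : Quotient s → F // ∀ e ∉ A,
        cq (Quotient.mk s (i e)) ≠ cq (Quotient.mk s (f e))} := by
  subst hs
  symm
  refine Nat.card_congr (Equiv.ofBijective (fun c => ⟨fun v => c.1 (Quotient.mk _ v),
    fun e he => congrArg c.1 (Quotient.sound (.rel _ _ ⟨e, he, rfl, rfl⟩)), c.2⟩) ⟨?_, ?_⟩)
  · intro c d h
    refine Subtype.ext (funext fun a => ?_)
    induction a using Quotient.inductionOn with
    | h v => exact congrFun (congrArg Subtype.val h) v
  · rintro ⟨x, hx, hx'⟩
    refine ⟨⟨Quotient.lift x fun u w h => ?_, hx'⟩, rfl⟩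
    induction h with
    | rel _ _ h =>
      obtain ⟨e, he, rfl, rfl⟩ := h
      exact hx e he
    | refl => rfl
    | symm _ _ _ ih => exact ih.symm
    | trans _ _ _ _ _ ih₁ ih₂ => exact ih₁.trans ih₂


/-- Let `G = (V,E,i,f)` be a multigraph and `F` a finite field with `q`
elements.  Let `F_G(q)` be the number of nowhere-zero flows on `G`, and for `A ⊆ E` let
`N_A = #{x : V → F | x(i e) = x(f e) for all e ∈ A and x(i e) ≠ x(f e) for all e ∉ A}`.
Then `q^{|V|} · F_G(q) = ∑_{A⊆E} (−1)^{|E|−|A|} (q−1)^{|A|} N_A`; moreover `N_A` equals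
`P_{G/A}(q)`, the number of proper colorings of the multigraph obtained from `G` by
contracting the edges of `A` (whose vertices are the classes of the equivalence relation
on `V` generated by `i e ∼ f e`, `e ∈ A`, and whose edges are those of `E∖A`). -/
theorem stmt_18 {V E F : Type*} [Fintype V] [DecidableEq V] [Fintype E]
    [Field F] [Fintype F]
    (i f : E → V)
    (FG : ℕ)
    (hFG : FG = Nat.card {k : E → F // (∀ e : E, k e ≠ 0) ∧ ∀ v : V,
        (∑ e ∈ Finset.univ.filter (fun e : E => f e = v), k e) -
          (∑ e ∈ Finset.univ.filter (fun e : E => i e = v), k e) = 0})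
    (N : Finset E → ℕ)
    (hN : ∀ A : Finset E,
      N A = Nat.card {x : V → F //
        (∀ e ∈ A, x (i e) = x (f e)) ∧ (∀ e ∉ A, x (i e) ≠ x (f e))})
    (SA : Finset E → Setoid V)
    (hSA : ∀ A : Finset E,
      SA A = Relation.EqvGen.setoid (fun u w : V => ∃ e ∈ A, i e = u ∧ f e = w)) :
    (Fintype.card F : ℤ) ^ (Fintype.card V) * FG =
      (∑ A : Finset E, (-1 : ℤ) ^ (Fintype.card E - A.card) *
        ((Fintype.card F : ℤ) - 1) ^ A.card * N A) ∧
    ∀ A : Finset E,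
      N A = Nat.card {cq : Quotient (SA A) → F // ∀ e ∉ A,
        cq (Quotient.mk (SA A) (i e)) ≠ cq (Quotient.mk (SA A) (f e))} := by
  classical
  refine ⟨?_, fun A => ?_⟩
  · simp_rw [hN, hFG]
    rw [card_pow_mul_card_nowhereZeroFlow, sum_prod_ite_eq_sum_finset]
  · rw [hN]
    exact card_coloring_eq_card_contraction i f A (SA A) (hSA A)
end
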